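/- arXiv:1811.08358 — 2 statements merged into one kernel-verified Lean document; each statement's English description precedes it below -/
import Mathlib

section
/- Let A be a d×d Hermitian matrix with spectral decomposition A = U Λ_α U*, where α ∈ ℝ^d_≥ is the non-increasingly ordered vector of eigenvalues of A and U is unitary. Let F : ℝ^d_≥ → ℝ^d be C¹ point-symmetric at α. Then the matrix function 𝓛_F is Fréchet differentiable at A (as a map between the real normed vector spaces of Hermitian d×d matrices), and for every Hermitian matrix E, setting Ê = U*EU and letting ê denote the vector of diagonal entries of Ê, the Fréchet derivative is given by 𝓛_F'(E) = U( [F,α] ∘ Ê + diag( ((F^ext)'|_α)^o ê ) )U*, where ∘ denotes Hadamard (entrywise) multiplication. -/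
open Matrix Filter

attribute [local instance] Matrix.frobeniusNormedAddCommGroup Matrix.frobeniusNormedSpace

/-- The matrix `[F,α]` of generalized divided differences, where `D` is the
(Fréchet) derivative of the extension `F^ext` at `α`, so that
`D (Pi.single n 1) m = ∂ₙ F^ext_m (α)`. -/
noncomputable def bracket {d : ℕ} (F : (Fin d → ℝ) → Fin d → ℝ)
    (D : (Fin d → ℝ) →L[ℝ] (Fin d → ℝ)) (α : Fin d → ℝ) (m n : Fin d) : ℝ :=
  if α m = α n then
    if m = n then D (Pi.single m 1) m
    else D (Pi.single m 1) m - D (Pi.single m 1) n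
  else (F α m - F α n) / (α m - α n)

lemma dk_herm_interp {d : ℕ} (α v w : Fin d → ℝ) (hv : ∀ m n, α m = α n → v m = v n)
    (hw : ∀ m n, α m = α n → w m = w n) :
    ∃ p : Polynomial ℝ, ∀ m, p.eval (α m) = v m ∧ p.derivative.eval (α m) = w m := by
  classical
  obtain ⟨v', hv'⟩ : ∃ v' : ℝ → ℝ, ∀ m, v' (α m) = v m :=
    ⟨Function.extend α v 0, fun m => Function.FactorsThrough.extend_apply
      (fun a b h => hv a b h) _ _⟩
  obtain ⟨w', hw'⟩ : ∃ w' : ℝ → ℝ, ∀ m, w' (α m) = w m :=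
    ⟨Function.extend α w 0, fun m => Function.FactorsThrough.extend_apply
      (fun a b h => hw a b h) _ _⟩
  set s : Finset ℝ := Finset.univ.image α with hs
  have hms : ∀ m, α m ∈ s := fun m => by simp [hs]
  let l : ℝ → Polynomial ℝ := fun x => Lagrange.basis s id x
  have l1 : ∀ x ∈ s, (l x).eval x = 1 := fun x hx =>
    Lagrange.eval_basis_self (v := id) (fun _ _ _ _ h => h) hx
  have l0 : ∀ x y, x ≠ y → y ∈ s → (l x).eval y = 0 := fun x y hxy hy =>
    Lagrange.eval_basis_of_ne (v := id) hxy hy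
  refine ⟨∑ x ∈ s, (Polynomial.C (v' x) + Polynomial.C (w' x) * (Polynomial.X - Polynomial.C x))
    * (3 * (l x) ^ 2 - 2 * (l x) ^ 3), fun m => ⟨?_, ?_⟩⟩
  · rw [Polynomial.eval_finsetSum, Finset.sum_eq_single (α m)]
    · simp [l1 _ (hms m), hv']; ring
    · intro y hy hne
      simp [l0 y (α m) hne (hms m)]
    · intro h; exact absurd (hms m) h
  · rw [Polynomial.derivative_sum, Polynomial.eval_finsetSum, Finset.sum_eq_single (α m)]
    · simp [Polynomial.derivative_pow, l1 _ (hms m), hw']; ring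
    · intro y hy hne
      simp [Polynomial.derivative_pow, l0 y (α m) hne (hms m)]
    · intro h; exact absurd (hms m) h

lemma dk_norm_le_sum {d : ℕ} (A : Matrix (Fin d) (Fin d) ℂ) :
    ‖A‖ ≤ ∑ i, ∑ j, ‖A i j‖ := by
  rw [Matrix.frobenius_norm_def, ← Real.sqrt_eq_rpow]
  apply Real.sqrt_le_iff.2 ⟨by positivity, ?_⟩
  simp only [Real.rpow_two]
  calc ∑ i, ∑ j, ‖A i j‖ ^ 2 ≤ ∑ i, (∑ j, ‖A i j‖) ^ 2 :=
        Finset.sum_le_sum fun i _ => Finset.sum_sq_le_sq_sum_of_nonneg fun _ _ => norm_nonneg _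
    _ ≤ _ := Finset.sum_sq_le_sq_sum_of_nonneg fun _ _ => by positivity

lemma dk_entry_le {d : ℕ} (A : Matrix (Fin d) (Fin d) ℂ) (i j : Fin d) : ‖A i j‖ ≤ ‖A‖ := by
  rw [Matrix.frobenius_norm_def, ← Real.sqrt_eq_rpow]
  apply Real.le_sqrt_of_sq_le
  simp only [Real.rpow_two]
  calc ‖A i j‖ ^ 2 ≤ ∑ j, ‖A i j‖ ^ 2 :=
        Finset.single_le_sum (f := fun j => ‖A i j‖ ^ 2) (fun _ _ => by positivity) (Finset.mem_univ j)
    _ ≤ _ := Finset.single_le_sum (f := fun i => ∑ j, ‖A i j‖ ^ 2) (fun _ _ => by positivity)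
      (Finset.mem_univ i)

noncomputable def dkS {d : ℕ} (V : Matrix (Fin d) (Fin d) ℂ) (x : Fin d → ℝ) :
    Matrix (Fin d) (Fin d) ℂ := V * Matrix.diagonal (fun i => (x i : ℂ)) * star V

lemma dkS_apply {d : ℕ} (V : Matrix (Fin d) (Fin d) ℂ) (x : Fin d → ℝ) (i j : Fin d) :
    dkS V x i j = ∑ k, V i k * (x k : ℂ) * star (V j k) := by
  simp [dkS, Matrix.mul_apply, Matrix.diagonal_apply]

lemma dkS_add {d : ℕ} (V : Matrix (Fin d) (Fin d) ℂ) (x y : Fin d → ℝ) :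
    dkS V (x + y) = dkS V x + dkS V y := by
  ext i j; simp [dkS_apply, mul_add, add_mul, Finset.sum_add_distrib]

lemma dkS_sub {d : ℕ} (V : Matrix (Fin d) (Fin d) ℂ) (x y : Fin d → ℝ) :
    dkS V (x - y) = dkS V x - dkS V y := by
  ext i j; simp [dkS_apply, mul_sub, sub_mul, Finset.sum_sub_distrib]

lemma dkS_smul {d : ℕ} (V : Matrix (Fin d) (Fin d) ℂ) (c : ℝ) (x : Fin d → ℝ) :
    dkS V (c • x) = c • dkS V x := by
  ext i j
  simp only [dkS_apply, Matrix.smul_apply, Finset.smul_sum]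
  refine Finset.sum_congr rfl fun k _ => ?_
  simp; ring

lemma dkS_sum {d : ℕ} {ι : Type*} (s : Finset ι) (V : Matrix (Fin d) (Fin d) ℂ) (x : ι → Fin d → ℝ) :
    dkS V (∑ i ∈ s, x i) = ∑ i ∈ s, dkS V (x i) := by
  classical
  induction s using Finset.induction_on with
  | empty => ext i j; simp [dkS_apply]
  | insert a s ha ih => rw [Finset.sum_insert ha, Finset.sum_insert ha, dkS_add, ih]

lemma dkS_bound {d : ℕ} (V : Matrix (Fin d) (Fin d) ℂ) (hV : V ∈ Matrix.unitaryGroup (Fin d) ℂ)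
    (x : Fin d → ℝ) : ‖dkS V x‖ ≤ (d : ℝ) ^ 3 * ‖x‖ := by
  have : ∀ i j, ‖dkS V x i j‖ ≤ d * ‖x‖ := by
    intro i j
    rw [dkS_apply]
    calc _ ≤ ∑ k, ‖V i k * (x k : ℂ) * star (V j k)‖ := norm_sum_le _ _
      _ ≤ ∑ k : Fin d, ‖x‖ := by
          refine Finset.sum_le_sum fun k _ => ?_
          rw [norm_mul, norm_mul, norm_star, Complex.norm_real]
          have h1 := entry_norm_bound_of_unitary hV i k
          have h2 := entry_norm_bound_of_unitary hV j k
          have h3 := norm_le_pi_norm x k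
          calc _ ≤ 1 * ‖x‖ * 1 := by gcongr
            _ = _ := by ring
      _ = _ := by simp
  calc _ ≤ _ := dk_norm_le_sum _
    _ ≤ ∑ i : Fin d, ∑ j : Fin d, d * ‖x‖ :=
      Finset.sum_le_sum fun i _ => Finset.sum_le_sum fun j _ => this i j
    _ = _ := by simp; ring

lemma dkS_perm {d : ℕ} (V : Matrix (Fin d) (Fin d) ℂ) (x : Fin d → ℝ) (σ : Equiv.Perm (Fin d)) :
    dkS (V.submatrix id σ) (x ∘ σ) = dkS V x := by
  ext i j
  simp only [dkS_apply, Matrix.submatrix_apply, id, Function.comp]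
  exact Equiv.sum_comp σ (fun k => V i k * (x k : ℂ) * star (V j k))

lemma dk_perm_unitary {d : ℕ} (V : Matrix (Fin d) (Fin d) ℂ)
    (hV : V ∈ Matrix.unitaryGroup (Fin d) ℂ) (σ : Equiv.Perm (Fin d)) :
    V.submatrix id σ ∈ Matrix.unitaryGroup (Fin d) ℂ := by
  rw [Matrix.mem_unitaryGroup_iff] at *
  have h := dkS_perm V 1 σ
  have h1 : dkS V 1 = 1 := by simp [dkS, hV]
  rw [h1] at h
  rw [← h]
  simp [dkS]

lemma dkS_poly {d : ℕ} (V : Matrix (Fin d) (Fin d) ℂ)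
    (hV : V ∈ Matrix.unitaryGroup (Fin d) ℂ) (x : Fin d → ℝ) (p : Polynomial ℝ) :
    Polynomial.aeval (dkS V x) p = dkS V (fun i => p.eval (x i)) := by
  have h1 := Matrix.mem_unitaryGroup_iff.1 hV
  have h2 := Matrix.mem_unitaryGroup_iff'.1 hV
  induction p using Polynomial.induction_on with
  | C a =>
    have : dkS V (fun _ => a) = a • dkS V 1 := by
      rw [← dkS_smul]; congr 1; ext; simp
    simp only [Polynomial.aeval_C, Polynomial.eval_C, this]
    simp [dkS, h1, Algebra.algebraMap_eq_smul_one]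
  | add p q hp hq =>
    rw [map_add, hp, hq, ← dkS_add]; congr 1; ext; simp
  | monomial n a ih =>
    rw [pow_succ, ← mul_assoc, map_mul, ih, Polynomial.aeval_X]
    simp only [dkS]
    have : ∀ P Q : Matrix (Fin d) (Fin d) ℂ, V * P * star V * (V * Q * star V)
        = V * (P * Q) * star V := by
      intro P Q
      calc _ = V * P * (star V * V) * Q * star V := by simp only [mul_assoc]
        _ = _ := by rw [h2]; simp only [mul_assoc, mul_one]
    rw [this, Matrix.diagonal_mul_diagonal]
    congr 3; ext i; simp

lemma dkS_trace {d : ℕ} (V : Matrix (Fin d) (Fin d) ℂ)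
    (hV : V ∈ Matrix.unitaryGroup (Fin d) ℂ) (x : Fin d → ℝ) :
    (dkS V x).trace = ((∑ i, x i : ℝ) : ℂ) := by
  have h2 := Matrix.mem_unitaryGroup_iff'.1 hV
  rw [dkS, Matrix.trace_mul_comm, ← mul_assoc, h2, one_mul, Matrix.trace_diagonal]
  push_cast; rfl

lemma dk_row_sum {d : ℕ} (V : Matrix (Fin d) (Fin d) ℂ) (h : V * star V = 1) (i : Fin d) :
    ∑ j, ‖V i j‖ ^ 2 = 1 := by
  have := congrFun (congrFun h i) i
  simp only [Matrix.mul_apply, Matrix.star_apply, Matrix.one_apply_eq] at this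
  have h2 : ((∑ j, ‖V i j‖ ^ 2 : ℝ) : ℂ) = 1 := by
    rw [← this]; push_cast
    refine Finset.sum_congr rfl fun j _ => ?_
    exact (Complex.mul_conj' _).symm
  exact_mod_cast h2

lemma dk_hoffman_wielandt {d : ℕ} (α : Fin d → ℝ) (B : Matrix (Fin d) (Fin d) ℂ)
    (hB : B.IsHermitian) : ∃ V ∈ Matrix.unitaryGroup (Fin d) ℂ, ∃ ξ : Fin d → ℝ,
      B = dkS V ξ ∧ ‖ξ - α‖ ≤ ‖B - Matrix.diagonal (fun i => (α i : ℂ))‖ := by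
  obtain ⟨W, hW, η, hη⟩ : ∃ W ∈ Matrix.unitaryGroup (Fin d) ℂ, ∃ η : Fin d → ℝ, B = dkS W η := by
    refine ⟨hB.eigenvectorUnitary, hB.eigenvectorUnitary.2, hB.eigenvalues, ?_⟩
    have := hB.spectral_theorem
    rw [Unitary.conjStarAlgAut_apply] at this
    exact this
  have h1 := Matrix.mem_unitaryGroup_iff.1 hW
  have h2 := Matrix.mem_unitaryGroup_iff'.1 hW
  set E := B - Matrix.diagonal (fun i => (α i : ℂ)) with hE
  have hEW : ∀ i j, (E * W) i j = ((η j - α i : ℝ) : ℂ) * W i j := by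
    intro i j
    have : E * W = W * Matrix.diagonal (fun i => (η i : ℂ))
        - Matrix.diagonal (fun i => (α i : ℂ)) * W := by
      rw [hE, sub_mul, hη, dkS, mul_assoc, h2, mul_one]
    rw [this]; simp; ring
  let P : Matrix (Fin d) (Fin d) ℝ := fun i j => ‖W i j‖ ^ 2
  have hP : P ∈ doublyStochastic ℝ (Fin d) := by
    rw [mem_doublyStochastic_iff_sum]
    refine ⟨fun i j => by positivity, fun i => dk_row_sum W h1 i, fun j => ?_⟩
    have := dk_row_sum (star W) (by simpa using h2) j
    simpa [P] using this
  have hnorm : ∀ M : Matrix (Fin d) (Fin d) ℂ, ‖M‖ ^ 2 = ∑ i, ∑ j, ‖M i j‖ ^ 2 := by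
    intro M
    rw [Matrix.frobenius_norm_def, ← Real.sqrt_eq_rpow, Real.sq_sqrt (by positivity)]
    simp
  have hinv : ‖E * W‖ ^ 2 = ‖E‖ ^ 2 := by
    have tr : ∀ M : Matrix (Fin d) (Fin d) ℂ, ((‖M‖ ^ 2 : ℝ) : ℂ) = (M * star M).trace := by
      intro M
      rw [hnorm, Matrix.trace]; push_cast
      refine Finset.sum_congr rfl fun i _ => ?_
      rw [Matrix.diag_apply, Matrix.mul_apply]
      refine Finset.sum_congr rfl fun j _ => ?_
      exact (Complex.mul_conj' _).symm
    have : ((‖E * W‖ ^ 2 : ℝ) : ℂ) = ((‖E‖ ^ 2 : ℝ) : ℂ) := by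
      rw [tr, tr, star_mul]
      congr 1
      calc _ = E * (W * star W) * star E := by simp only [mul_assoc]
        _ = _ := by rw [h1, mul_one]
    exact_mod_cast this
  obtain ⟨w, w0, w1, hw⟩ := exists_eq_sum_perm_of_mem_doublyStochastic hP
  have key : ∑ σ : Equiv.Perm (Fin d), w σ * ∑ i, (η (σ i) - α i) ^ 2 = ‖E‖ ^ 2 := by
    rw [← hinv, hnorm]
    have : ∀ i j, ‖(E * W) i j‖ ^ 2 = ∑ σ : Equiv.Perm (Fin d),
        w σ * ((if σ i = j then 1 else 0) * (η j - α i) ^ 2) := by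
      intro i j
      have hij : ‖W i j‖ ^ 2 = ∑ σ : Equiv.Perm (Fin d), w σ * (if σ i = j then 1 else 0) := by
        have := congrFun (congrFun hw i) j
        rw [Matrix.sum_apply] at this
        change P i j = _
        rw [← this]
        refine Finset.sum_congr rfl fun σ _ => ?_
        simp [Equiv.Perm.permMatrix, PEquiv.toMatrix_apply, eq_comm]
      rw [hEW, norm_mul, mul_pow, hij, Complex.norm_real, Real.norm_eq_abs, sq_abs, Finset.mul_sum]
      refine Finset.sum_congr rfl fun σ _ => by ring
    simp only [this]
    rw [Finset.sum_congr rfl fun i _ => Finset.sum_comm, Finset.sum_comm]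
    refine Finset.sum_congr rfl fun σ _ => ?_
    rw [Finset.mul_sum]
    refine Finset.sum_congr rfl fun i _ => ?_
    simp
  obtain ⟨σ, hσ⟩ : ∃ σ : Equiv.Perm (Fin d), ∑ i, (η (σ i) - α i) ^ 2 ≤ ‖E‖ ^ 2 := by
    by_contra! hcon
    have : ∑ σ : Equiv.Perm (Fin d), w σ * ‖E‖ ^ 2 <
        ∑ σ : Equiv.Perm (Fin d), w σ * ∑ i, (η (σ i) - α i) ^ 2 := by
      apply Finset.sum_lt_sum
      · intro σ _
        exact mul_le_mul_of_nonneg_left (hcon σ).le (w0 σ)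
      · obtain ⟨σ, _, hσ⟩ := Finset.exists_ne_zero_of_sum_ne_zero (w1.trans_ne one_ne_zero)
        exact ⟨σ, Finset.mem_univ _, mul_lt_mul_of_pos_left (hcon σ)
          (lt_of_le_of_ne (w0 σ) (Ne.symm hσ))⟩
    rw [key, ← Finset.sum_mul, w1, one_mul] at this
    exact lt_irrefl _ this
  refine ⟨W.submatrix id σ, dk_perm_unitary W hW σ, η ∘ σ, by rw [dkS_perm, hη], ?_⟩
  rw [pi_norm_le_iff_of_nonneg (norm_nonneg _)]
  intro i
  rw [Real.norm_eq_abs]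
  apply abs_le_of_sq_le_sq _ (norm_nonneg _)
  exact (Finset.single_le_sum (f := fun i => (η (σ i) - α i) ^ 2) (fun _ _ => by positivity)
    (Finset.mem_univ i)).trans hσ

noncomputable def dkdd (p : Polynomial ℝ) (x y : ℝ) : ℝ :=
  if x = y then p.derivative.eval x else (p.eval x - p.eval y) / (x - y)

lemma dk_hasFDerivAt_mul {d : ℕ} {f g : Matrix (Fin d) (Fin d) ℂ → Matrix (Fin d) (Fin d) ℂ}
    {f' g' : Matrix (Fin d) (Fin d) ℂ →L[ℝ] Matrix (Fin d) (Fin d) ℂ}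
    {a : Matrix (Fin d) (Fin d) ℂ}
    (hf : HasFDerivAt f f' a) (hg : HasFDerivAt g g' a) :
    ∃ L : Matrix (Fin d) (Fin d) ℂ →L[ℝ] Matrix (Fin d) (Fin d) ℂ,
      HasFDerivAt (fun B => f B * g B) L a ∧ ∀ E, L E = f a * g' E + f' E * g a := by
  let _ : NormedRing (Matrix (Fin d) (Fin d) ℂ) := Matrix.frobeniusNormedRing
  let _ : NormedAlgebra ℝ (Matrix (Fin d) (Fin d) ℂ) := Matrix.frobeniusNormedAlgebra
  exact ⟨_, HasFDerivAt.mul' hf hg, fun E => rfl⟩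

lemma dk_poly_deriv {d : ℕ} (α : Fin d → ℝ) (p : Polynomial ℝ) :
    ∃ L : Matrix (Fin d) (Fin d) ℂ →L[ℝ] Matrix (Fin d) (Fin d) ℂ,
      HasFDerivAt (fun B : Matrix (Fin d) (Fin d) ℂ => Polynomial.aeval B p) L
        (Matrix.diagonal (fun i => (α i : ℂ))) ∧
      ∀ E m n, L E m n = (dkdd p (α m) (α n) : ℂ) * E m n := by
  have hev : ∀ p : Polynomial ℝ, Polynomial.aeval (Matrix.diagonal (fun i => (α i : ℂ))) p
      = Matrix.diagonal (fun i => ((p.eval (α i) : ℝ) : ℂ)) := by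
    intro p
    have := dkS_poly (1 : Matrix (Fin d) (Fin d) ℂ) (one_mem _) α p
    simpa [dkS] using this
  induction p using Polynomial.induction_on with
  | C a =>
    refine ⟨0, ?_, ?_⟩
    · simp only [Polynomial.aeval_C]; exact hasFDerivAt_const _ _
    · intro E m n; simp [dkdd]
  | add p q hp hq =>
    obtain ⟨L, hL, hL'⟩ := hp
    obtain ⟨M, hM, hM'⟩ := hq
    refine ⟨L + M, ?_, ?_⟩
    · simp only [map_add]; exact hL.add hM
    · intro E m n
      have : dkdd (p + q) (α m) (α n) = dkdd p (α m) (α n) + dkdd q (α m) (α n) := by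
        unfold dkdd; split_ifs
        · simp
        · simp; ring
      rw [this, _root_.add_apply, Matrix.add_apply, hL', hM']; push_cast; ring
  | monomial k a ih =>
    obtain ⟨L, hL, hL'⟩ := ih
    set p := Polynomial.C a * Polynomial.X ^ k with hp
    have hpp : Polynomial.C a * Polynomial.X ^ (k + 1) = p * Polynomial.X := by
      rw [hp, pow_succ, mul_assoc]
    rw [hpp]
    obtain ⟨M, hM, hM'⟩ := dk_hasFDerivAt_mul hL (hasFDerivAt_id _)
    refine ⟨M, ?_, ?_⟩
    · simp only [map_mul, Polynomial.aeval_X]; exact hM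
    · intro E m n
      have : dkdd (p * Polynomial.X) (α m) (α n) = p.eval (α m) + dkdd p (α m) (α n) * α n := by
        unfold dkdd; split_ifs with h
        · simp [h]; ring
        · have : α m - α n ≠ 0 := sub_ne_zero.2 h
          simp; field_simp; ring
      rw [this, hM', hev]
      simp [hL']; ring

/-- Block structure of a matrix `D` commuting with the stabilizer of `α`. -/
lemma dk_block {d : ℕ} (α : Fin d → ℝ) (D : Fin d → Fin d → ℝ)
    (hD : ∀ σ : Equiv.Perm (Fin d), α ∘ σ = α → ∀ m n, D (σ m) (σ n) = D m n) :
    ∃ (c : Fin d → ℝ) (t : Fin d → Fin d → ℝ),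
      (∀ m n, α m = α n → c m = c n) ∧
      (∀ m n k, α m = α n → t m k = t n k) ∧ (∀ m n k, α m = α n → t k m = t k n) ∧
      (∀ m n, D m n = t m n + if m = n then c m else 0) ∧
      (∀ m n, α m = α n → m ≠ n → c m = D m m - D n m) := by
  have sw : ∀ i j, α i = α j → ∀ m n, D (Equiv.swap i j m) (Equiv.swap i j n) = D m n := by
    intro i j hij
    apply hD
    ext k
    simp only [Function.comp, Equiv.swap_apply_def]
    split_ifs with h1 h2 <;> simp_all
  have row : ∀ i j k, α i = α j → k ≠ i → k ≠ j → D i k = D j k := by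
    intro i j k h h1 h2
    have := sw i j h i k
    rw [Equiv.swap_apply_left, Equiv.swap_apply_of_ne_of_ne h1 h2] at this
    exact this.symm
  have col : ∀ i j k, α i = α j → k ≠ i → k ≠ j → D k i = D k j := by
    intro i j k h h1 h2
    have := sw i j h k i
    rw [Equiv.swap_apply_left, Equiv.swap_apply_of_ne_of_ne h1 h2] at this
    exact this.symm
  have dg : ∀ i j, α i = α j → D i i = D j j := by
    intro i j h
    have := sw i j h i i
    rw [Equiv.swap_apply_left] at this
    exact this.symm
  have off : ∀ i j, α i = α j → D i j = D j i := by
    intro i j h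
    have := sw i j h i j
    rw [Equiv.swap_apply_left, Equiv.swap_apply_right] at this
    exact this.symm
  classical
  obtain ⟨c, hc⟩ : ∃ c : Fin d → ℝ, ∀ m n, α m = α n → m ≠ n → c m = D m m - D n m := by
    refine ⟨fun m => if h : ∃ n, α m = α n ∧ m ≠ n then D m m - D h.choose m else 0, ?_⟩
    intro m n hmn hne
    have h : ∃ n, α m = α n ∧ m ≠ n := ⟨n, hmn, hne⟩
    simp only [h, dite_true]
    rw [row h.choose n m (h.choose_spec.1.symm.trans hmn) h.choose_spec.2 hne]
  refine ⟨c, fun m n => D m n - if m = n then c m else 0, ?_, ?_, ?_, ?_, hc⟩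
  · intro m n h
    by_cases hne : m = n
    · rw [hne]
    · rw [hc m n h hne, hc n m h.symm (Ne.symm hne), dg m n h, off m n h]
  · intro m n k h
    by_cases hne : m = n
    · rw [hne]
    by_cases h1 : m = k
    · subst h1
      have := hc m n h hne
      simp [Ne.symm hne]; linarith
    · by_cases h2 : n = k
      · subst h2
        have := hc n m h.symm (Ne.symm hne)
        simp [hne]; linarith
      · simp [h1, h2, row m n k h (Ne.symm h1) (Ne.symm h2)]
  · intro m n k h
    by_cases hne : m = n
    · rw [hne]
    by_cases h1 : k = m
    · subst h1
      have := hc k n h hne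
      have := off k n h
      simp [hne]; linarith
    · by_cases h2 : k = n
      · subst h2
        have := hc k m h.symm (Ne.symm hne)
        have := off k m h.symm
        simp [Ne.symm hne]; linarith
      · simp [h1, h2, col m n k h h1 h2]
  · intro m n; simp

lemma dkS_isLittleO {d : ℕ} {X : Type*} {l : Filter X} {g : X → ℝ}
    {V : X → Matrix (Fin d) (Fin d) ℂ} (hV : ∀ B, V B ∈ Matrix.unitaryGroup (Fin d) ℂ)
    {x : X → Fin d → ℝ} (hx : x =o[l] g) : (fun B => dkS (V B) (x B)) =o[l] g := by
  refine Asymptotics.IsBigO.trans_isLittleO ?_ hx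
  exact Asymptotics.IsBigO.of_bound ((d : ℝ) ^ 3)
    (Eventually.of_forall fun B => dkS_bound _ (hV B) _)

lemma dk_poly_scalar {X : Type*} {l : Filter X} {g : X → ℝ} (q : Polynomial ℝ) (a : ℝ) (ξ : X → ℝ)
    (hξ : Tendsto ξ l (nhds a)) (hO : (fun B => ξ B - a) =O[l] g) :
    (fun B => q.eval (ξ B) - q.eval a - q.derivative.eval a * (ξ B - a)) =o[l] g := by
  have h := (q.hasDerivAt a).isLittleO.comp_tendsto hξ
  refine Asymptotics.IsLittleO.trans_isBigO ?_ hO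
  refine h.congr (fun B => ?_) (fun B => rfl)
  simp [mul_comm]

noncomputable def dkReTr (d : ℕ) : Matrix (Fin d) (Fin d) ℂ →L[ℝ] ℝ :=
  LinearMap.toContinuousLinearMap
    { toFun := fun M => M.trace.re
      map_add' := fun M N => by simp
      map_smul' := fun c M => by simp }

noncomputable def dkEntry {d : ℕ} (n : Fin d) : Matrix (Fin d) (Fin d) ℂ →L[ℝ] ℝ :=
  LinearMap.toContinuousLinearMap
    { toFun := fun M => (M n n).re
      map_add' := fun M N => by simp
      map_smul' := fun c M => by simp }

lemma dkReTr_apply {d : ℕ} (M : Matrix (Fin d) (Fin d) ℂ) : dkReTr d M = M.trace.re := rfl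

lemma dkEntry_apply {d : ℕ} (n : Fin d) (M : Matrix (Fin d) (Fin d) ℂ) :
    dkEntry n M = (M n n).re := rfl

lemma dk_core {d : ℕ} (α : Fin d → ℝ) (G : (Fin d → ℝ) → Fin d → ℝ)
    (D : (Fin d → ℝ) →L[ℝ] (Fin d → ℝ))
    (LF : Matrix (Fin d) (Fin d) ℂ → Matrix (Fin d) (Fin d) ℂ)
    (hsym : ∀ (x : Fin d → ℝ) (σ : Equiv.Perm (Fin d)), G (x ∘ σ) = G x ∘ σ)
    (hD : HasFDerivAt G D α)
    (hLF : ∀ V ∈ Matrix.unitaryGroup (Fin d) ℂ, ∀ ξ, LF (dkS V ξ) = dkS V (G ξ)) :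
    ∃ L : Matrix (Fin d) (Fin d) ℂ →L[ℝ] Matrix (Fin d) (Fin d) ℂ,
      HasFDerivWithinAt LF L {B | B.IsHermitian} (Matrix.diagonal (fun i => (α i : ℂ))) ∧
      ∀ E : Matrix (Fin d) (Fin d) ℂ, E.IsHermitian →
        L E = (Matrix.of fun m n => (bracket G D α m n : ℂ) * E m n)
          + Matrix.diagonal (fun m => ∑ n ∈ Finset.univ.erase m,
              (D (Pi.single n 1) m : ℂ) * E n n) := by
  classical
  set a : Matrix (Fin d) (Fin d) ℂ := Matrix.diagonal (fun i => (α i : ℂ)) with ha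
  -- symmetry of the derivative
  have hDsym : ∀ σ : Equiv.Perm (Fin d), α ∘ σ = α → ∀ h : Fin d → ℝ, D (h ∘ σ) = D h ∘ σ := by
    intro σ hσ h
    let P : (Fin d → ℝ) →L[ℝ] (Fin d → ℝ) :=
      LinearMap.toContinuousLinearMap (LinearMap.funLeft ℝ ℝ σ)
    have hP : ∀ x, P x = x ∘ σ := fun x => rfl
    have e1 : HasFDerivAt (fun x => G (P x)) (D.comp P) α :=
      HasFDerivAt.comp (g := G) α (by rw [hP, hσ]; exact hD) P.hasFDerivAt
    have e2 : HasFDerivAt (fun x => P (G x)) (P.comp D) α :=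
      HasFDerivAt.comp (g := P) α P.hasFDerivAt hD
    have e3 : (fun x => G (P x)) = fun x => P (G x) := by
      funext x; rw [hP, hP, hsym]
    rw [e3] at e1
    have := congrArg (fun T => T h) (e1.unique e2)
    exact this
  have hDm : ∀ σ : Equiv.Perm (Fin d), α ∘ σ = α → ∀ m n,
      D (Pi.single (σ n) 1) (σ m) = D (Pi.single n 1) m := by
    intro σ hσ m n
    have h1 := hDsym σ hσ (Pi.single (σ n) 1)
    have h2 : (Pi.single (σ n) (1 : ℝ) : Fin d → ℝ) ∘ σ = Pi.single n 1 := by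
      ext k; simp [Pi.single_apply]
    rw [h2] at h1
    rw [h1]; rfl
  obtain ⟨c, t, hc, htr, htc, hDt, hcD⟩ := dk_block α (fun m n => D (Pi.single n 1) m) hDm
  have hDapp : ∀ x m, D x m = c m * x m + ∑ n, t m n * x n := by
    intro x m
    have hx : x = ∑ n, x n • (Pi.single n (1 : ℝ) : Fin d → ℝ) := by
      ext k; simp [Finset.sum_apply, Pi.single_apply]
    conv_lhs => rw [hx]
    rw [map_sum, Finset.sum_apply]
    have : ∀ n, (D (x n • (Pi.single n (1 : ℝ) : Fin d → ℝ))) m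
        = t m n * x n + if m = n then c m * x n else 0 := by
      intro n
      rw [map_smul, Pi.smul_apply, hDt, smul_eq_mul]; split_ifs <;> ring
    simp only [this, Finset.sum_add_distrib, Finset.sum_ite_eq, Finset.mem_univ, if_true]
    ring
  have hG : ∀ m n, α m = α n → G α m = G α n := by
    intro m n h
    have h1 : α ∘ (Equiv.swap m n) = α := by
      ext k
      simp only [Function.comp, Equiv.swap_apply_def]
      split_ifs with h1 h2 <;> simp_all
    have := congrFun (hsym α (Equiv.swap m n)) m
    rw [h1] at this
    simpa using this
  obtain ⟨p, hp⟩ := dk_herm_interp α (G α) c hG hc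
  obtain ⟨Lp, hLp, hLp'⟩ := dk_poly_deriv α p
  let T : Fin d → Matrix (Fin d) (Fin d) ℂ := fun n => Matrix.diagonal (fun m => (t m n : ℂ))
  let L : Matrix (Fin d) (Fin d) ℂ →L[ℝ] Matrix (Fin d) (Fin d) ℂ :=
    Lp + ∑ n, (dkEntry n).smulRight (T n)
  have hL : ∀ E, L E = Lp E + ∑ n, (E n n).re • T n := by
    intro E
    simp [L, _root_.add_apply, dkEntry_apply]
  refine ⟨L, ?_, ?_⟩
  swap
  · intro E hE
    have hre : ∀ n, (((E n n).re : ℝ) : ℂ) = E n n := fun n => hE.coe_re_apply_self n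
    rw [hL]
    ext m n
    rw [Matrix.add_apply, Matrix.add_apply, hLp', Matrix.sum_apply, Matrix.of_apply]
    by_cases hmn : m = n
    · subst hmn
      simp only [Matrix.smul_apply, T, Matrix.diagonal_apply_eq, bracket, if_true, dkdd]
      rw [← Finset.add_sum_erase Finset.univ _ (Finset.mem_univ m), (hp m).2, hDt m m, ← add_assoc]
      congr 1
      · simp [hre]; ring
      · refine Finset.sum_congr rfl fun k hk => ?_
        have hk' : m ≠ k := (Finset.ne_of_mem_erase hk).symm
        rw [hDt m k]
        simp [hk', hre]; ring
    · simp only [Matrix.smul_apply, T, Matrix.diagonal_apply_ne _ hmn, smul_zero,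
        Finset.sum_const_zero, add_zero]
      congr 2
      unfold dkdd bracket
      split_ifs with h
      · rw [(hp m).2]; exact hcD m n h hmn
      · rw [(hp m).1, (hp n).1]
  -- the little-o estimate
  have hch : ∀ B : Matrix (Fin d) (Fin d) ℂ, ∃ V : Matrix (Fin d) (Fin d) ℂ, ∃ ξ : Fin d → ℝ,
      V ∈ Matrix.unitaryGroup (Fin d) ℂ ∧
      (B.IsHermitian → B = dkS V ξ ∧ ‖ξ - α‖ ≤ ‖B - a‖) := by
    intro B
    by_cases hB : B.IsHermitian
    · obtain ⟨V, hV, ξ, h⟩ := dk_hoffman_wielandt α B hB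
      exact ⟨V, ξ, hV, fun _ => h⟩
    · exact ⟨1, 0, one_mem _, fun h => absurd h hB⟩
  choose V ξ hV hBξ using hch
  set l := nhdsWithin a {B : Matrix (Fin d) (Fin d) ℂ | B.IsHermitian} with hl
  have hmem : ∀ᶠ B in l, B.IsHermitian := self_mem_nhdsWithin
  let g : Matrix (Fin d) (Fin d) ℂ → ℝ := fun B => ‖B - a‖
  have hδ : (fun B => ξ B - α) =O[l] g := by
    refine Asymptotics.IsBigO.of_bound 1 (hmem.mono fun B hB => ?_)
    simpa [g] using (hBξ B hB).2
  have hg0 : Tendsto g l (nhds 0) := by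
    have : Tendsto (fun B => ‖B - a‖) (nhds a) (nhds 0) := by
      have := (tendsto_iff_norm_sub_tendsto_zero (f := fun B => B) (b := a) (a := nhds a)).1 tendsto_id
      exact this
    exact this.mono_left nhdsWithin_le_nhds
  have hξ : Tendsto ξ l (nhds α) := by
    have := hδ.trans_tendsto hg0
    simpa using this.add_const α
  have hξi : ∀ i, Tendsto (fun B => ξ B i) l (nhds (α i)) := fun i => tendsto_pi_nhds.1 hξ i
  have hδi : ∀ i, (fun B => ξ B i - α i) =O[l] g := fun i =>
    (Asymptotics.isBigO_pi.1 hδ) i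
  have hev : ∀ q : Polynomial ℝ, Polynomial.aeval a q
      = Matrix.diagonal (fun i => ((q.eval (α i) : ℝ) : ℂ)) := by
    intro q
    have := dkS_poly (1 : Matrix (Fin d) (Fin d) ℂ) (one_mem _) α q
    simpa [dkS] using this
  -- polynomial calculus estimate
  have hpoly : ∀ (q : Polynomial ℝ) (M : Matrix (Fin d) (Fin d) ℂ →L[ℝ] Matrix (Fin d) (Fin d) ℂ),
      HasFDerivAt (fun B : Matrix (Fin d) (Fin d) ℂ => Polynomial.aeval B q) M a →
      (fun B => Polynomial.aeval B q - Polynomial.aeval a q - M (B - a)) =o[l] g := by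
    intro q M hM
    exact (hM.isLittleO.mono nhdsWithin_le_nhds).trans_isBigO
      (Asymptotics.isBigO_refl _ _).norm_right
  have claim1 : ∀ m, (fun B => ∑ n, t m n * (ξ B n - α n) - ∑ n, t m n * ((B - a) n n).re) =o[l] g := by
    intro m
    obtain ⟨q, hq⟩ := dk_herm_interp α 0 (t m) (fun _ _ _ => rfl) (fun i j h => htc i j m h)
    obtain ⟨M, hM, hM'⟩ := dk_poly_deriv α q
    have e1 : (fun B => (Polynomial.aeval B q - Polynomial.aeval a q - M (B - a)).trace.re) =o[l] g :=
      ((dkReTr d).isBigO_comp _ l).trans_isLittleO (hpoly q M hM)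
    have e2 : (fun B => ∑ n, (q.eval (ξ B n) - q.eval (α n)
        - q.derivative.eval (α n) * (ξ B n - α n))) =o[l] g :=
      Asymptotics.IsLittleO.fun_sum fun n _ => dk_poly_scalar q (α n) _ (hξi n) (hδi n)
    refine (e1.sub e2).congr' (hmem.mono fun B hB => ?_) EventuallyEq.rfl
    have hB1 := (hBξ B hB).1
    simp only [Matrix.trace_sub, Complex.sub_re]
    have f1 : (Polynomial.aeval B q).trace.re = ∑ n, q.eval (ξ B n) := by
      conv_lhs => rw [hB1]
      rw [dkS_poly _ (hV B), dkS_trace _ (hV B), Complex.ofReal_re]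
    have f2 : (Polynomial.aeval a q).trace.re = 0 := by
      rw [hev]; simp [hq]
    have f3 : (M (B - a)).trace.re = ∑ n, t m n * ((B - a) n n).re := by
      simp only [Matrix.trace, Complex.re_sum, Matrix.diag_apply, hM']
      refine Finset.sum_congr rfl fun n _ => ?_
      simp [dkdd, hq]
    rw [f1, f2, f3]
    simp only [hq, Finset.sum_sub_distrib, Pi.zero_apply]
    simp
  have claim2 : ∀ n, Tendsto (fun B => dkS (V B) (fun m => t m n) - T n) l (nhds 0) := by
    intro n
    obtain ⟨r, hr⟩ := dk_herm_interp α (fun m => t m n) 0 (fun i j h => htr i j n h)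
      (fun _ _ _ => rfl)
    obtain ⟨M, hM, hM'⟩ := dk_poly_deriv α r
    have e1 : Tendsto (fun B : Matrix (Fin d) (Fin d) ℂ => Polynomial.aeval B r) l
        (nhds (Polynomial.aeval a r)) := hM.continuousAt.tendsto.mono_left nhdsWithin_le_nhds
    have e2 : (fun B => (fun i => r.eval (ξ B i) - r.eval (α i) : Fin d → ℝ)) =o[l]
        (fun _ => (1 : ℝ)) := by
      refine Asymptotics.isLittleO_pi.2 fun i => ?_
      rw [Asymptotics.isLittleO_one_iff]
      have := (r.continuous.tendsto (α i)).comp (hξi i)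
      simpa using this.sub_const (r.eval (α i))
    have e3 := (Asymptotics.isLittleO_one_iff ℝ).1 (dkS_isLittleO hV e2)
    have e4 := (e1.sub_const (Polynomial.aeval a r)).sub e3
    rw [sub_self, sub_zero] at e4
    refine e4.congr' (hmem.mono fun B hB => ?_)
    have hB1 := (hBξ B hB).1
    have f1 : Polynomial.aeval B r = dkS (V B) (fun i => r.eval (ξ B i)) := by
      conv_lhs => rw [hB1]
      rw [dkS_poly _ (hV B)]
    have f2 : Polynomial.aeval a r = T n := by
      rw [hev]; simp [hr, T]
    have f3 : (fun i => r.eval (ξ B i) - r.eval (α i) : Fin d → ℝ)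
        = (fun i => r.eval (ξ B i)) - fun m => t m n := by
      ext i; simp [hr]
    rw [f1, f2, f3, dkS_sub]; abel
  have main1 : (fun B => dkS (V B) (fun m => G (ξ B) m - p.eval (ξ B m)
      - ∑ n, t m n * (ξ B n - α n))) =o[l] g := by
    apply dkS_isLittleO hV
    refine Asymptotics.isLittleO_pi.2 fun m => ?_
    have e1 : (fun B => G (ξ B) - G α - D (ξ B - α)) =o[l] g :=
      (hD.isLittleO.comp_tendsto hξ).trans_isBigO hδ
    have e2 := (Asymptotics.isLittleO_pi.1 e1) m
    have e3 := dk_poly_scalar p (α m) _ (hξi m) (hδi m)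
    refine (e2.sub e3).congr (fun B => ?_) (fun _ => rfl)
    simp only [Pi.sub_apply, hDapp, (hp m).1, (hp m).2]
    ring
  have main3 : (fun B => dkS (V B) (fun m => ∑ n, t m n * (ξ B n - α n)
      - ∑ n, t m n * ((B - a) n n).re)) =o[l] g :=
    dkS_isLittleO hV (Asymptotics.isLittleO_pi.2 claim1)
  have main4 : (fun B => ∑ n, ((B - a) n n).re • (dkS (V B) (fun m => t m n) - T n)) =o[l] g := by
    refine Asymptotics.IsLittleO.fun_sum fun n _ => ?_
    have e1 : (fun B => ((B - a) n n).re) =O[l] g := by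
      refine Asymptotics.IsBigO.of_bound 1 (Eventually.of_forall fun B => ?_)
      simp only [g, norm_norm, one_mul]
      exact (Complex.abs_re_le_norm _).trans (dk_entry_le _ _ _)
    have e2 := (Asymptotics.isLittleO_one_iff ℝ).2 (claim2 n)
    have := e1.smul_isLittleO e2
    simpa using this
  have tot := ((main1.add (hpoly p Lp hLp)).add main3).add main4
  refine hasFDerivWithinAt_iff_isLittleO.2 ?_
  refine Asymptotics.IsLittleO.of_norm_right (tot.congr' (hmem.mono fun B hB => ?_) EventuallyEq.rfl)
  have hB1 := (hBξ B hB).1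
  have f1 : LF B = dkS (V B) (G (ξ B)) := by
    conv_lhs => rw [hB1]
    exact hLF _ (hV B) _
  have f2 : LF a = Polynomial.aeval a p := by
    have : a = dkS 1 α := by simp [dkS, ha]
    conv_lhs => rw [this]
    rw [hLF 1 (one_mem _), hev]
    simp [dkS, hp]
  have f3 : Polynomial.aeval B p = dkS (V B) (fun i => p.eval (ξ B i)) := by
    conv_lhs => rw [hB1]
    rw [dkS_poly _ (hV B)]
  have f4 : (fun m => G (ξ B) m - p.eval (ξ B m) - ∑ n, t m n * (ξ B n - α n))
      = G (ξ B) - (fun i => p.eval (ξ B i)) - (fun m => ∑ n, t m n * (ξ B n - α n)) := rfl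
  have f5 : (fun m => ∑ n, t m n * (ξ B n - α n) - ∑ n, t m n * ((B - a) n n).re)
      = (fun m => ∑ n, t m n * (ξ B n - α n)) - ∑ n, ((B - a) n n).re • (fun m => t m n) := by
    ext m; simp [Finset.sum_apply, mul_comm]
  refine Eq.trans ?_ (show LF B - LF a - (Lp (B - a) + ∑ n, ((B - a) n n).re • T n)
    = LF B - LF a - L (B - a) by rw [hL])
  simp only [f1, f2, f3, f4, f5, dkS_sub, dkS_sum, dkS_smul, smul_sub, Finset.sum_sub_distrib]
  abel

lemma dk_star_conj_herm {d : ℕ} (U B : Matrix (Fin d) (Fin d) ℂ) (hB : B.IsHermitian) :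
    (star U * B * U).IsHermitian := by
  rw [Matrix.IsHermitian, ← Matrix.star_eq_conjTranspose] at *
  simp [star_mul, hB, mul_assoc]

noncomputable def dkConj {d : ℕ} (P Q : Matrix (Fin d) (Fin d) ℂ) :
    Matrix (Fin d) (Fin d) ℂ →L[ℝ] Matrix (Fin d) (Fin d) ℂ :=
  LinearMap.toContinuousLinearMap
    { toFun := fun M => P * M * Q
      map_add' := fun M N => by rw [mul_add, add_mul]
      map_smul' := fun c M => by simp }

lemma dkConj_apply {d : ℕ} (P Q M : Matrix (Fin d) (Fin d) ℂ) : dkConj P Q M = P * M * Q := rfl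

/-- **Generalized Daleskii–Krein theorem** (Theorem 1 of the paper).
Let `A = U Λ_α U*` be Hermitian with non-increasingly ordered eigenvalues `α`,
let `F` be a vector field on `ℝ^d_≥` that is C¹ point-symmetric at `α`
(i.e. its extension `F^ext` is point-symmetric and C¹ at `α`, with derivative `D`),
and let `𝓛_F` be the associated matrix function.  Then `𝓛_F` is Fréchet
differentiable at `A` (as a map between the real normed spaces of Hermitian
matrices, with the Frobenius norm), and for every Hermitian `E`, writing
`Ê = U* E U` and `ê = diag Ê`,
`𝓛_F'(E) = U ([F,α] ∘ Ê + diag((F^ext)'|_α)^o ê) U*`. -/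
theorem daleskii_krein_vector_field {d : ℕ}
    (F Fext : (Fin d → ℝ) → Fin d → ℝ)
    (A U : Matrix (Fin d) (Fin d) ℂ) (α : Fin d → ℝ)
    (LF : Matrix (Fin d) (Fin d) ℂ → Matrix (Fin d) (Fin d) ℂ)
    (D : (Fin d → ℝ) →L[ℝ] (Fin d → ℝ))
    (hA : A.IsHermitian)
    (hU : U ∈ Matrix.unitaryGroup (Fin d) ℂ)
    (hα : Antitone α)
    (hAdec : A = U * Matrix.diagonal (fun i => (α i : ℂ)) * star U)
    -- `Fext` is the extension `F^ext` of `F`, obtained by sorting the argument: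
    (hFext : ∀ x : Fin d → ℝ, ∃ σ : Equiv.Perm (Fin d),
      Antitone (x ∘ σ) ∧ Fext x = F (x ∘ σ) ∘ σ.symm)
    -- `F` is C¹ point-symmetric at `α`: `F^ext` is point-symmetric and C¹ at `α`:
    (hsym : ∀ (x : Fin d → ℝ) (σ : Equiv.Perm (Fin d)), Fext (x ∘ σ) = Fext x ∘ σ)
    (hC1 : ContDiffAt ℝ 1 Fext α)
    (hD : HasFDerivAt Fext D α)
    -- `LF` is the matrix function `𝓛_F` determined by spectral decompositions:
    (hLF : ∀ (B V : Matrix (Fin d) (Fin d) ℂ) (ξ : Fin d → ℝ),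
      V ∈ Matrix.unitaryGroup (Fin d) ℂ → Antitone ξ →
      B = V * Matrix.diagonal (fun i => (ξ i : ℂ)) * star V →
      LF B = V * Matrix.diagonal (fun i => (F ξ i : ℂ)) * star V) :
    ∃ L : Matrix (Fin d) (Fin d) ℂ →L[ℝ] Matrix (Fin d) (Fin d) ℂ,
      HasFDerivWithinAt LF L {B | B.IsHermitian} A ∧
      ∀ E : Matrix (Fin d) (Fin d) ℂ, E.IsHermitian →
        L E = U * ((Matrix.of fun m n =>
            (bracket F D α m n : ℂ) * (star U * E * U) m n)
          + Matrix.diagonal (fun m => ∑ n ∈ Finset.univ.erase m,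
              (D (Pi.single n 1) m : ℂ) * (star U * E * U) n n)) * star U := by
  have hFα : F α = Fext α := by
    obtain ⟨σ, h1, h2⟩ := hFext α
    have h3 : α ∘ σ = α := Tuple.unique_antitone (τ := Equiv.refl _) h1 hα
    rw [h3] at h2
    have h4 := hsym α σ
    rw [h3, h2] at h4
    rw [h2, h4]
    ext i; simp
  have hLF' : ∀ V ∈ Matrix.unitaryGroup (Fin d) ℂ, ∀ ξ, LF (dkS V ξ) = dkS V (Fext ξ) := by
    intro V hV ξ
    obtain ⟨σ, h1, h2⟩ := hFext ξ
    have h3 : F (ξ ∘ σ) = Fext ξ ∘ σ := by rw [h2]; ext i; simp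
    have h4 := hLF (dkS V ξ) (V.submatrix id σ) (ξ ∘ σ) (dk_perm_unitary V hV σ) h1
      (dkS_perm V ξ σ).symm
    rw [h4, ← dkS_perm V (Fext ξ) σ, ← h3]; rfl
  obtain ⟨L, hL, hL'⟩ := dk_core α Fext D LF hsym hD hLF'
  have h1 := Matrix.mem_unitaryGroup_iff.1 hU
  have h2 := Matrix.mem_unitaryGroup_iff'.1 hU
  have hA' : star U * A * U = Matrix.diagonal (fun i => (α i : ℂ)) := by
    rw [hAdec]
    calc _ = (star U * U) * Matrix.diagonal (fun i => (α i : ℂ)) * (star U * U) := by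
          simp only [mul_assoc]
      _ = _ := by rw [h2, one_mul, mul_one]
  have hback : ∀ B : Matrix (Fin d) (Fin d) ℂ, U * (star U * B * U) * star U = B := by
    intro B
    calc _ = (U * star U) * B * (U * star U) := by simp only [mul_assoc]
      _ = _ := by rw [h1, one_mul, mul_one]
  have hLFc : ∀ B : Matrix (Fin d) (Fin d) ℂ, B.IsHermitian →
      LF B = dkConj U (star U) (LF (dkConj (star U) U B)) := by
    intro B hB
    obtain ⟨V, hV, ξ, hVξ, -⟩ := dk_hoffman_wielandt α _ (dk_star_conj_herm U B hB)
    have hBe : B = dkS (U * V) ξ := by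
      rw [← hback B, hVξ]; simp [dkS, star_mul, mul_assoc]
    rw [dkConj_apply, dkConj_apply, hVξ, hLF' V hV]
    conv_lhs => rw [hBe]
    rw [hLF' _ (mul_mem hU hV)]
    simp [dkS, star_mul, mul_assoc]
  refine ⟨(dkConj U (star U)).comp (L.comp (dkConj (star U) U)), ?_, ?_⟩
  · have e0 : HasFDerivWithinAt LF L {B | B.IsHermitian} (dkConj (star U) U A) := by
      rw [dkConj_apply, hA']; exact hL
    have e1 : HasFDerivWithinAt (fun B => LF (dkConj (star U) U B)) (L.comp (dkConj (star U) U))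
        {B | B.IsHermitian} A :=
      HasFDerivWithinAt.comp A e0 (dkConj (star U) U).hasFDerivWithinAt
        (fun B hB => dk_star_conj_herm U B hB)
    have e2 := (dkConj U (star U)).hasFDerivAt.comp_hasFDerivWithinAt A e1
    exact e2.congr (fun B hB => hLFc B hB) (hLFc A hA)
  · intro E hE
    have hb : ∀ m n, bracket F D α m n = bracket Fext D α m n := by
      intro m n; simp only [bracket, hFα]
    change U * (L (star U * E * U)) * star U = _
    rw [hL' _ (dk_star_conj_herm U E hE)]
    simp only [hb]
end

section
/- If F : ℝ^d → ℝ^d is a C¹ point-symmetric vector-field in a neighborhood of α ∈ ℝ^d_≥, where α is the non-increasingly ordered eigenvalue vector of a Hermitian d×d matrix A, then the map 𝓛_F is Fréchet differentiable at A, viewed as a map from the real normed vector space of Hermitian d×d matrices to itself. -/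
open Matrix Filter

attribute [local instance] Matrix.frobeniusNormedAddCommGroup Matrix.frobeniusNormedSpace

lemma aux_hermite (T : Finset ℝ) (f g : ℝ → ℝ) :
    ∃ p : Polynomial ℝ, ∀ v ∈ T, p.eval v = f v ∧ p.derivative.eval v = g v := by
  classical
  let L := Lagrange.interpolate T id f
  let N := Lagrange.nodal T (id : ℝ → ℝ)
  let R := Lagrange.interpolate T id
    (fun v => (g v - L.derivative.eval v) / N.derivative.eval v)
  have hinj : Set.InjOn (id : ℝ → ℝ) T := Function.injective_id.injOn
  refine ⟨L + N * R, fun v hv => ?_⟩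
  have hL : L.eval v = f v := Lagrange.eval_interpolate_at_node f hinj hv
  have hN : N.eval v = 0 := Lagrange.eval_nodal_at_node (v := (id : ℝ → ℝ)) hv
  have hR : R.eval v = (g v - L.derivative.eval v) / N.derivative.eval v :=
    Lagrange.eval_interpolate_at_node _ hinj hv
  have hN' : N.derivative.eval v ≠ 0 := by
    have h1 := Lagrange.nodalWeight_ne_zero hinj hv
    rw [Lagrange.nodalWeight_eq_eval_derivative_nodal hv] at h1
    exact fun h => h1 (by simpa using h)
  constructor
  · simp [hL, hN]
  · simp only [Polynomial.derivative_add, Polynomial.derivative_mul, Polynomial.eval_add,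
      Polynomial.eval_mul, hR, hN]
    field_simp
    ring

lemma aux_perm {d : ℕ} {α : Fin d → ℝ} {i j i' j' : Fin d} (hij : i ≠ j) (hij' : i' ≠ j')
    (hi : α i = α i') (hj : α j = α j') :
    ∃ σ : Equiv.Perm (Fin d), α ∘ σ = α ∧ σ i = i' ∧ σ j = j' := by
  have key : ∀ a b : Fin d, α a = α b → ∀ x, α (Equiv.swap a b x) = α x := by
    intro a b h x
    rw [Equiv.swap_apply_def]
    split_ifs with h1 h2
    · rw [h1, h]
    · rw [h2, h]
    · rfl
  have hne : Equiv.swap i i' j ≠ i' := by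
    intro h
    have := (Equiv.swap i i').injective (h.trans (Equiv.swap_apply_left i i').symm)
    exact hij this.symm
  refine ⟨Equiv.swap (Equiv.swap i i' j) j' * Equiv.swap i i', ?_, ?_, ?_⟩
  · funext x
    simp only [Function.comp_apply, Equiv.Perm.mul_apply]
    rw [key _ _ _, key _ _ hi]
    rw [key _ _ hi, hj]
  · simp only [Equiv.Perm.mul_apply, Equiv.swap_apply_left]
    exact Equiv.swap_apply_of_ne_of_ne hne.symm hij'
  · simp [Equiv.Perm.mul_apply]

lemma aux_deriv_symm {d : ℕ} {F : (Fin d → ℝ) → Fin d → ℝ} {α : Fin d → ℝ}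
    {s : Set (Fin d → ℝ)} (hs : s ∈ nhds α)
    (hsym : ∀ x ∈ s, ∀ σ : Equiv.Perm (Fin d), F (x ∘ σ) = F x ∘ σ)
    {M : (Fin d → ℝ) →L[ℝ] (Fin d → ℝ)} (hM : HasFDerivAt F M α)
    (σ : Equiv.Perm (Fin d)) (hσ : α ∘ σ = α) (i j : Fin d) :
    M (Pi.single (σ j) 1) (σ i) = M (Pi.single j 1) i := by
  let P : (Fin d → ℝ) →L[ℝ] (Fin d → ℝ) :=
    ContinuousLinearMap.pi fun k => ContinuousLinearMap.proj (σ k)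
  have hP : ∀ x, P x = x ∘ σ := fun x => rfl
  have h1 : HasFDerivAt (fun x => F (P x)) (M.comp P) α := by
    refine HasFDerivAt.comp α ?_ P.hasFDerivAt
    rw [hP, hσ]; exact hM
  have h2 : HasFDerivAt (fun x => P (F x)) (P.comp M) α := P.hasFDerivAt.comp α hM
  have h3 : (fun x => F (P x)) =ᶠ[nhds α] (fun x => P (F x)) := by
    filter_upwards [hs] with x hx
    exact hsym x hx σ
  have h4 := h1.unique (h2.congr_of_eventuallyEq h3)
  have h5 := congrFun (DFunLike.congr_fun h4 (Pi.single (σ j) 1)) i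
  have h6 : P (Pi.single (σ j) 1) = Pi.single j 1 := by
    rw [hP]; funext k
    simp [Pi.single_apply]
  simp only [ContinuousLinearMap.comp_apply, h6] at h5
  exact h5.symm

/-- structure of the derivative -/
lemma aux_struct {d : ℕ} {F : (Fin d → ℝ) → Fin d → ℝ} {α : Fin d → ℝ}
    {s : Set (Fin d → ℝ)} (hs : s ∈ nhds α)
    (hsym : ∀ x ∈ s, ∀ σ : Equiv.Perm (Fin d), F (x ∘ σ) = F x ∘ σ)
    {M : (Fin d → ℝ) →L[ℝ] (Fin d → ℝ)} (hM : HasFDerivAt F M α) :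
    ∃ (c a : ℝ → ℝ) (b : ℝ → ℝ → ℝ), (∀ i, F α i = c (α i)) ∧
      ∀ h i, M h i = a (α i) * h i + ∑ j, b (α i) (α j) * h j := by
  have hone : ∀ i i' : Fin d, α i = α i' → ∃ σ : Equiv.Perm (Fin d), α ∘ σ = α ∧ σ i = i' := by
    intro i i' h
    refine ⟨Equiv.swap i i', ?_, by simp⟩
    funext x
    simp only [Function.comp_apply]
    rw [Equiv.swap_apply_def]
    split_ifs with h1 h2
    · rw [h1, h]
    · rw [h2, h]
    · rfl
  have hc : Function.FactorsThrough (F α) α := by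
    intro i i' h
    obtain ⟨σ, h1, h2⟩ := hone i i' h
    have := congrFun (hsym α (mem_of_mem_nhds hs) σ) i
    rw [h1] at this
    simpa [h2] using this
  let φ : {p : Fin d × Fin d // p.1 ≠ p.2} → ℝ × ℝ := fun p => (α p.1.1, α p.1.2)
  let m : {p : Fin d × Fin d // p.1 ≠ p.2} → ℝ := fun p => M (Pi.single p.1.2 1) p.1.1
  have hb : Function.FactorsThrough m φ := by
    rintro ⟨⟨i, j⟩, hij⟩ ⟨⟨i', j'⟩, hij'⟩ h
    simp only [φ, Prod.mk.injEq] at h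
    obtain ⟨σ, h1, h2, h3⟩ := aux_perm hij hij' h.1 h.2
    have := aux_deriv_symm hs hsym hM σ h1 i j
    simp only [m]
    rw [← this, h2, h3]
  let b : ℝ → ℝ → ℝ := fun u v => Function.extend φ m 0 (u, v)
  have hbe : ∀ i j, i ≠ j → b (α i) (α j) = M (Pi.single j 1) i := fun i j hij =>
    hb.extend_apply 0 ⟨(i, j), hij⟩
  let D : Fin d → ℝ := fun i => M (Pi.single i 1) i - b (α i) (α i)
  have ha : Function.FactorsThrough D α := by
    intro i i' h
    obtain ⟨σ, h1, h2⟩ := hone i i' h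
    have := aux_deriv_symm hs hsym hM σ h1 i i
    simp only [D]
    rw [← this, h2, h]
  refine ⟨Function.extend α (F α) 0, Function.extend α D 0, b, fun i => (hc.extend_apply 0 i).symm,
    fun h i => ?_⟩
  rw [ha.extend_apply 0 i]
  have e : M h i = ∑ j, M (Pi.single j 1) i * h j := by
    conv_lhs => rw [← Finset.univ_sum_single h, map_sum, Finset.sum_apply]
    refine Finset.sum_congr rfl fun j _ => ?_
    have : (Pi.single j (h j) : Fin d → ℝ) = h j • Pi.single j 1 := by
      rw [← Pi.single_smul]; simp
    rw [this, map_smul]; simp [mul_comm]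
  rw [e, ← Finset.add_sum_erase _ _ (Finset.mem_univ i),
    ← Finset.add_sum_erase _ (fun j => b (α i) (α j) * h j) (Finset.mem_univ i)]
  have : ∑ x ∈ Finset.univ.erase i, M (Pi.single x 1) i * h x
      = ∑ x ∈ Finset.univ.erase i, b (α i) (α x) * h x := by
    refine Finset.sum_congr rfl fun j hj => ?_
    rw [hbe i j (Finset.ne_of_mem_erase hj).symm]
  rw [this]
  simp only [D]
  ring

/-- scalar model -/
lemma aux_model {d : ℕ} {F : (Fin d → ℝ) → Fin d → ℝ} {α : Fin d → ℝ}
    {s : Set (Fin d → ℝ)} (hs : s ∈ nhds α)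
    (hsym : ∀ x ∈ s, ∀ σ : Equiv.Perm (Fin d), F (x ∘ σ) = F x ∘ σ)
    {M : (Fin d → ℝ) →L[ℝ] (Fin d → ℝ)} (hM : HasFDerivAt F M α) :
    ∃ (T : Finset ℝ) (q : Polynomial ℝ) (r p : ℝ → Polynomial ℝ),
      (∀ i, F α i = q.eval (α i) + ∑ v ∈ T, (∑ j, (r v).eval (α j)) * (p v).eval (α i)) ∧
      HasFDerivAt (fun (x : Fin d → ℝ) i =>
        q.eval (x i) + ∑ v ∈ T, (∑ j, (r v).eval (x j)) * (p v).eval (x i)) M α := by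
  classical
  obtain ⟨c, a, b, hc, hab⟩ := aux_struct hs hsym hM
  let T := Finset.univ.image α
  have hT : ∀ i, α i ∈ T := fun i => Finset.mem_image_of_mem _ (Finset.mem_univ i)
  obtain ⟨q, hq⟩ := aux_hermite T c a
  choose r hr using fun v => aux_hermite T 0 (b v)
  choose p hp using fun v => aux_hermite T (fun u => if u = v then 1 else 0) 0
  refine ⟨T, q, r, p, fun i => ?_, ?_⟩
  · have : ∀ v, ∑ j, (r v).eval (α j) = 0 := fun v =>
      Finset.sum_eq_zero fun j _ => (hr v _ (hT j)).1
    simp [this, hc, (hq _ (hT i)).1]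
  · rw [hasFDerivAt_pi']
    intro i
    have hpol : ∀ (P : Polynomial ℝ) (k : Fin d), HasFDerivAt (fun x : Fin d → ℝ => P.eval (x k))
        (P.derivative.eval (α k) • (ContinuousLinearMap.proj k : (Fin d → ℝ) →L[ℝ] ℝ)) α := by
      intro P k
      exact (P.hasDerivAt (α k)).comp_hasFDerivAt α
        ((ContinuousLinearMap.proj k : (Fin d → ℝ) →L[ℝ] ℝ).hasFDerivAt)
    have := (hpol q i).add (HasFDerivAt.fun_sum (u := T) fun v _ =>
      (HasFDerivAt.fun_sum (u := Finset.univ) fun j _ => hpol (r v) j).mul (hpol (p v) i))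
    refine this.congr_fderiv ?_
    ext1 h
    have h0 : ∀ v, ∑ j, (r v).eval (α j) = 0 := fun v =>
      Finset.sum_eq_zero fun j _ => (hr v _ (hT j)).1
    simp [h0, hab, (hq _ (hT i)).2, (hp _ _ (hT i)).1, (hr _ _ (hT _)).2, hT]

lemma aux_aeval {d : ℕ} {V : Matrix (Fin d) (Fin d) ℂ} (hV : V ∈ Matrix.unitaryGroup (Fin d) ℂ)
    (ξ : Fin d → ℝ) (p : Polynomial ℝ) :
    Polynomial.aeval (V * Matrix.diagonal (fun i => (ξ i : ℂ)) * star V) p =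
      V * Matrix.diagonal (fun i => ((p.eval (ξ i) : ℝ) : ℂ)) * star V := by
  have h1 : star V * V = 1 := (Unitary.mem_iff.1 hV).1
  have h2 : V * star V = 1 := (Unitary.mem_iff.1 hV).2
  have hpow : ∀ n : ℕ, (V * Matrix.diagonal (fun i => (ξ i : ℂ)) * star V) ^ n =
      V * Matrix.diagonal (fun i => (ξ i : ℂ) ^ n) * star V := by
    intro n
    induction n with
    | zero => simp [h2]
    | succ n ih =>
      rw [pow_succ, ih]
      calc _ = V * Matrix.diagonal (fun i => (ξ i : ℂ) ^ n) * (star V * V) *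
            Matrix.diagonal (fun i => (ξ i : ℂ)) * star V := by simp only [mul_assoc]
        _ = _ := by
          rw [h1, mul_one, mul_assoc V, Matrix.diagonal_mul_diagonal]; simp only [pow_succ]
  induction p using Polynomial.induction_on' with
  | add p q hp hq =>
    rw [map_add, hp, hq, ← add_mul, ← mul_add, Matrix.diagonal_add]
    simp
  | monomial n a =>
    rw [Polynomial.aeval_monomial, hpow, ← Algebra.smul_def, ← smul_mul_assoc, ← mul_smul_comm,
      ← Matrix.diagonal_smul]
    congr 3
    funext i
    simp

lemma aux_trace {d : ℕ} {V : Matrix (Fin d) (Fin d) ℂ} (hV : V ∈ Matrix.unitaryGroup (Fin d) ℂ)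
    (x : Fin d → ℂ) :
    Matrix.trace (V * Matrix.diagonal x * star V) = ∑ i, x i := by
  have h1 : star V * V = 1 := (Unitary.mem_iff.1 hV).1
  rw [Matrix.trace_mul_comm, ← mul_assoc, h1, one_mul, Matrix.trace_diagonal]

lemma aux_diff_aeval {d : ℕ} (p : Polynomial ℝ) :
    Differentiable ℝ (fun B : Matrix (Fin d) (Fin d) ℂ => Polynomial.aeval B p) := by
  let _ := Matrix.frobeniusNormedRing (m := Fin d) (α := ℂ)
  let _ := Matrix.frobeniusNormedAlgebra (R := ℝ) (m := Fin d) (α := ℂ)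
  induction p using Polynomial.induction_on' with
  | add p q hp hq => simp only [map_add]; exact hp.add hq
  | monomial n a =>
    simp only [Polynomial.aeval_monomial, ← Algebra.smul_def]
    exact (differentiable_id.pow n).const_smul a

lemma aux_spectral {d : ℕ} {B : Matrix (Fin d) (Fin d) ℂ} (hB : B.IsHermitian) :
    ∃ V ∈ Matrix.unitaryGroup (Fin d) ℂ, ∃ ξ : Fin d → ℝ, Antitone ξ ∧
      B = V * Matrix.diagonal (fun i => (ξ i : ℂ)) * star V := by
  let τ : Equiv.Perm (Fin d) := Tuple.sort (fun i => - hB.eigenvalues i)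
  have hτ := Tuple.monotone_sort (fun i => - hB.eigenvalues i)
  let W : Matrix (Fin d) (Fin d) ℂ := hB.eigenvectorUnitary
  have hW := hB.eigenvectorUnitary.2
  have h1 : star W * W = 1 := (Unitary.mem_iff.1 hW).1
  have h2 : W * star W = 1 := (Unitary.mem_iff.1 hW).2
  have hs : star (W.submatrix id τ) = (star W).submatrix τ id := by
    ext; simp [Matrix.star_apply]
  refine ⟨W.submatrix id τ, ?_, hB.eigenvalues ∘ τ, ?_, ?_⟩
  · refine Unitary.mem_iff.2 ⟨?_, ?_⟩
    · rw [hs, ← Matrix.submatrix_mul _ _ _ _ _ Function.bijective_id, h1]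
      simp
    · rw [hs, ← Matrix.submatrix_mul _ _ _ _ _ τ.bijective, h2]
      simp
  · intro i j hij
    have := hτ hij
    simpa using this
  · have e := hB.spectral_theorem
    rw [Unitary.conjStarAlgAut_apply] at e
    have hd : Matrix.diagonal (fun i => ((hB.eigenvalues ∘ τ) i : ℂ)) =
        (Matrix.diagonal (fun i => (hB.eigenvalues i : ℂ))).submatrix τ τ := by
      rw [Matrix.submatrix_diagonal_equiv]; rfl
    rw [hs, hd, ← Matrix.submatrix_mul _ _ _ _ _ τ.bijective,
      ← Matrix.submatrix_mul _ _ _ _ _ τ.bijective, Matrix.submatrix_id_id]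
    exact e

lemma aux_entry {d : ℕ} (H : Matrix (Fin d) (Fin d) ℂ) (i j : Fin d) : ‖H i j‖ ≤ ‖H‖ := by
  have h1 : ‖H‖ = ‖WithLp.toLp 2 fun i => WithLp.toLp 2 fun j => H i j‖ := rfl
  rw [h1]
  refine le_trans ?_ (PiLp.norm_apply_le _ i)
  exact PiLp.norm_apply_le (WithLp.toLp 2 fun j => H i j) j

lemma aux_conj_norm {d : ℕ} : ∃ C : ℝ, 0 ≤ C ∧ ∀ V ∈ Matrix.unitaryGroup (Fin d) ℂ,
    ∀ x : Fin d → ℝ, ‖V * Matrix.diagonal (fun i => (x i : ℂ)) * star V‖ ≤ C * ‖x‖ := by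
  have hle : ∀ H : Matrix (Fin d) (Fin d) ℂ, ∀ c : ℝ, 0 ≤ c → (∀ i j, ‖H i j‖ ≤ c) → ‖H‖ ≤ d * c := by
    intro H c hc h
    rw [Matrix.frobenius_norm_def, ← Real.sqrt_eq_rpow]
    refine Real.sqrt_le_iff.2 ⟨by positivity, ?_⟩
    calc ∑ i, ∑ j, ‖H i j‖ ^ (2 : ℝ) ≤ ∑ i : Fin d, ∑ j : Fin d, c ^ 2 := by
          gcongr with i _ j _
          rw [Real.rpow_two]
          exact pow_le_pow_left₀ (norm_nonneg _) (h i j) 2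
      _ = _ := by simp; ring
  refine ⟨d * d, by positivity, fun V hV x => ?_⟩
  rw [mul_assoc (d : ℝ)]
  refine hle _ (d * ‖x‖) (by positivity) fun i j => ?_
  rw [Matrix.mul_apply]
  calc _ ≤ ∑ k, ‖(V * Matrix.diagonal (fun i => (x i : ℂ))) i k * (star V) k j‖ := norm_sum_le _ _
    _ ≤ ∑ k : Fin d, ‖x‖ := by
      gcongr with k _
      rw [Matrix.mul_diagonal, Matrix.star_apply, norm_mul, norm_mul, norm_star]
      have a1 := entry_norm_bound_of_unitary hV i k
      have a2 := entry_norm_bound_of_unitary hV j k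
      have a3 := norm_le_pi_norm x k
      rw [Complex.norm_real]
      calc _ ≤ 1 * ‖x‖ * 1 := by gcongr
        _ = _ := by ring
    _ = _ := by simp

lemma aux_quad {d : ℕ} {V : Matrix (Fin d) (Fin d) ℂ} (ξ : Fin d → ℝ) (x : Fin d → ℂ) :
    star x ⬝ᵥ ((V * Matrix.diagonal (fun i => (ξ i : ℂ)) * star V) *ᵥ x) =
      ((∑ i, ξ i * ‖(star V *ᵥ x) i‖ ^ 2 : ℝ) : ℂ) := by
  have h : star x ⬝ᵥ ((V * Matrix.diagonal (fun i => (ξ i : ℂ)) * star V) *ᵥ x) =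
      star (star V *ᵥ x) ⬝ᵥ (Matrix.diagonal (fun i => (ξ i : ℂ)) *ᵥ (star V *ᵥ x)) := by
    rw [Matrix.star_mulVec, ← Matrix.dotProduct_mulVec, Matrix.mulVec_mulVec, Matrix.mulVec_mulVec,
      Matrix.star_eq_conjTranspose, Matrix.conjTranspose_conjTranspose, mul_assoc]
  rw [h, dotProduct]
  push_cast
  refine Finset.sum_congr rfl fun i _ => ?_
  rw [Matrix.mulVec_diagonal, Pi.star_apply, mul_left_comm, ← Complex.conj_mul']
  rfl

lemma aux_norm_pres {d : ℕ} {V : Matrix (Fin d) (Fin d) ℂ}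
    (hV : V ∈ Matrix.unitaryGroup (Fin d) ℂ) (x : Fin d → ℂ) :
    ∑ i, ‖(star V *ᵥ x) i‖ ^ 2 = ∑ i, ‖x i‖ ^ 2 := by
  have h2 : V * star V = 1 := (Unitary.mem_iff.1 hV).2
  have h := aux_quad (V := V) (fun _ => 1) x
  have h' := aux_quad (V := (1 : Matrix (Fin d) (Fin d) ℂ)) (fun _ => 1) x
  have e : Matrix.diagonal (fun _ : Fin d => ((1 : ℝ) : ℂ)) = 1 := by simp
  simp only [e, mul_one, h2, star_one, one_mul, Matrix.one_mulVec] at h h'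
  exact_mod_cast h.symm.trans h'

lemma aux_form_bound {d : ℕ} (H : Matrix (Fin d) (Fin d) ℂ) (x : Fin d → ℂ) :
    ‖star x ⬝ᵥ (H *ᵥ x)‖ ≤ d * ‖H‖ * ∑ i, ‖x i‖ ^ 2 := by
  have h1 : ‖star x ⬝ᵥ (H *ᵥ x)‖ ≤ ∑ i, ∑ j, ‖x i‖ * (‖H‖ * ‖x j‖) := by
    rw [dotProduct]
    refine (norm_sum_le _ _).trans ?_
    gcongr with i _
    rw [norm_mul, Pi.star_apply, norm_star, ← Finset.mul_sum]
    gcongr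
    rw [Matrix.mulVec, dotProduct]
    refine (norm_sum_le _ _).trans ?_
    gcongr with j _
    rw [norm_mul]
    gcongr
    exact aux_entry H i j
  refine h1.trans ?_
  have h2 : ∑ i, ∑ j, ‖x i‖ * (‖H‖ * ‖x j‖) = ‖H‖ * (∑ i, ‖x i‖) ^ 2 := by
    rw [sq, Finset.sum_mul_sum, Finset.mul_sum]
    refine Finset.sum_congr rfl fun i _ => ?_
    rw [Finset.mul_sum]
    refine Finset.sum_congr rfl fun j _ => ?_
    ring
  rw [h2]
  have h3 : (∑ i, ‖x i‖) ^ 2 ≤ d * ∑ i, ‖x i‖ ^ 2 := by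
    simpa using sq_sum_le_card_mul_sum_sq (s := Finset.univ) (f := fun i => ‖x i‖)
  calc _ ≤ ‖H‖ * (d * ∑ i, ‖x i‖ ^ 2) := by gcongr
    _ = _ := by ring

lemma aux_weyl {d : ℕ} {U V : Matrix (Fin d) (Fin d) ℂ}
    (hU : U ∈ Matrix.unitaryGroup (Fin d) ℂ) (hV : V ∈ Matrix.unitaryGroup (Fin d) ℂ)
    {α ξ : Fin d → ℝ} (hα : Antitone α) (hξ : Antitone ξ) (i : Fin d) :
    ξ i - α i ≤ d * ‖V * Matrix.diagonal (fun i => (ξ i : ℂ)) * star V -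
      U * Matrix.diagonal (fun i => (α i : ℂ)) * star U‖ := by
  set B := V * Matrix.diagonal (fun i => (ξ i : ℂ)) * star V with hB
  set A := U * Matrix.diagonal (fun i => (α i : ℂ)) * star U with hA
  let N : Matrix (Fin d) (Fin d) ℂ := Matrix.of fun k j =>
    if k < i then (star U) k j else if k = i then 0 else (star V) k j
  have hdet : N.det = 0 := Matrix.det_eq_zero_of_row_eq_zero i (fun j => by simp [N])
  obtain ⟨x, hx0, hx⟩ := Matrix.exists_mulVec_eq_zero_iff.2 hdet
  have hxU : ∀ k, k < i → (star U *ᵥ x) k = 0 := by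
    intro k hk
    have := congrFun hx k
    simpa [N, Matrix.mulVec, dotProduct, hk] using this
  have hxV : ∀ k, i < k → (star V *ᵥ x) k = 0 := by
    intro k hk
    have := congrFun hx k
    simpa [N, Matrix.mulVec, dotProduct, hk.not_gt, hk.ne'] using this
  have hpos : 0 < ∑ i, ‖x i‖ ^ 2 := by
    obtain ⟨k, hk⟩ := Function.ne_iff.1 hx0
    refine Finset.sum_pos' (fun _ _ => by positivity) ⟨k, Finset.mem_univ k, ?_⟩
    have : 0 < ‖x k‖ := norm_pos_iff.2 hk
    positivity
  have e1 : ξ i * ∑ i, ‖x i‖ ^ 2 ≤ ∑ j, ξ j * ‖(star V *ᵥ x) j‖ ^ 2 := by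
    rw [← aux_norm_pres hV x, Finset.mul_sum]
    refine Finset.sum_le_sum fun j _ => ?_
    rcases le_or_gt j i with h | h
    · gcongr
      exact hξ h
    · simp [hxV j h]
  have e2 : ∑ j, α j * ‖(star U *ᵥ x) j‖ ^ 2 ≤ α i * ∑ i, ‖x i‖ ^ 2 := by
    rw [← aux_norm_pres hU x, Finset.mul_sum]
    refine Finset.sum_le_sum fun j _ => ?_
    rcases lt_or_ge j i with h | h
    · simp [hxU j h]
    · gcongr
      exact hα h
  have e3 := aux_form_bound (B - A) x
  rw [Matrix.sub_mulVec, dotProduct_sub, hB, hA, aux_quad, aux_quad, ← hB, ← hA,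
    ← Complex.ofReal_sub, Complex.norm_real] at e3
  have e4 := (le_abs_self _).trans e3
  have : (ξ i - α i) * ∑ i, ‖x i‖ ^ 2 ≤ d * ‖B - A‖ * ∑ i, ‖x i‖ ^ 2 := by
    rw [sub_mul]; linarith
  exact le_of_mul_le_mul_right this hpos

lemma aux_weyl_norm {d : ℕ} {U V : Matrix (Fin d) (Fin d) ℂ}
    (hU : U ∈ Matrix.unitaryGroup (Fin d) ℂ) (hV : V ∈ Matrix.unitaryGroup (Fin d) ℂ)
    {α ξ : Fin d → ℝ} (hα : Antitone α) (hξ : Antitone ξ) :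
    ‖ξ - α‖ ≤ d * ‖V * Matrix.diagonal (fun i => (ξ i : ℂ)) * star V -
      U * Matrix.diagonal (fun i => (α i : ℂ)) * star U‖ := by
  refine (pi_norm_le_iff_of_nonneg (by positivity)).2 fun i => ?_
  rw [Pi.sub_apply, Real.norm_eq_abs, abs_le]
  have h1 := aux_weyl hU hV hα hξ i
  have h2 := aux_weyl hV hU hξ hα i
  rw [norm_sub_rev] at h2
  constructor <;> linarith

/-- **Proposition (Fréchet differentiability of `𝓛_F`).**
If `F : ℝ^d → ℝ^d` is a C¹ point-symmetric vector field in a neighborhood `s`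
of `α`, where `α` is the non-increasingly ordered eigenvalue vector of the
Hermitian matrix `A = U Λ_α U*`, then the matrix function `𝓛_F` is Fréchet
differentiable at `A`, viewed as a map from the real normed vector space of
Hermitian `d × d` matrices to itself (with the Frobenius norm).  -/
theorem LF_frechet_differentiable {d : ℕ}
    (F : (Fin d → ℝ) → Fin d → ℝ)
    (A U : Matrix (Fin d) (Fin d) ℂ) (α : Fin d → ℝ)
    (LF : Matrix (Fin d) (Fin d) ℂ → Matrix (Fin d) (Fin d) ℂ)
    (s : Set (Fin d → ℝ))
    (hA : A.IsHermitian)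
    (hU : U ∈ Matrix.unitaryGroup (Fin d) ℂ)
    (hα : Antitone α)
    (hAdec : A = U * Matrix.diagonal (fun i => (α i : ℂ)) * star U)
    -- `s` is a neighborhood of `α` on which `F` is point-symmetric and C¹:
    (hs : s ∈ nhds α)
    (hsym : ∀ x ∈ s, ∀ σ : Equiv.Perm (Fin d), F (x ∘ σ) = F x ∘ σ)
    (hC1 : ContDiffOn ℝ 1 F s)
    -- `LF` is the matrix function `𝓛_F` determined by spectral decompositions:
    (hLF : ∀ (B V : Matrix (Fin d) (Fin d) ℂ) (ξ : Fin d → ℝ),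
      V ∈ Matrix.unitaryGroup (Fin d) ℂ → Antitone ξ → ξ ∈ s →
      B = V * Matrix.diagonal (fun i => (ξ i : ℂ)) * star V →
      LF B = V * Matrix.diagonal (fun i => (F ξ i : ℂ)) * star V) :
    DifferentiableWithinAt ℝ LF {B | B.IsHermitian} A := by
  classical
  have hM := ((hC1.contDiffAt hs).differentiableAt one_ne_zero).hasFDerivAt
  set M := fderiv ℝ F α
  obtain ⟨T, q, r, p, hG0, hG⟩ := aux_model hs hsym hM
  let G : (Fin d → ℝ) → Fin d → ℝ := fun x i =>
        q.eval (x i) + ∑ v ∈ T, (∑ j, (r v).eval (x j)) * (p v).eval (x i)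
  let Q : Matrix (Fin d) (Fin d) ℂ → Matrix (Fin d) (Fin d) ℂ := fun B =>
    Polynomial.aeval B q + ∑ v ∈ T,
      (Matrix.trace (Polynomial.aeval B (r v))) • Polynomial.aeval B (p v)
  have hQd : Differentiable ℝ Q := by
    refine (aux_diff_aeval q).add (Differentiable.fun_sum fun v _ => ?_)
    have htr : Differentiable ℝ (fun B : Matrix (Fin d) (Fin d) ℂ =>
        Matrix.trace (Polynomial.aeval B (r v))) :=
      ((Matrix.traceLinearMap (Fin d) ℝ ℂ).toContinuousLinearMap.differentiable).comp
      (aux_diff_aeval (r v))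
    exact htr.smul (aux_diff_aeval (p v))
  have hQ : ∀ V ∈ Matrix.unitaryGroup (Fin d) ℂ, ∀ ξ : Fin d → ℝ,
      Q (V * Matrix.diagonal (fun i => (ξ i : ℂ)) * star V) =
        V * Matrix.diagonal (fun i => (G ξ i : ℂ)) * star V := by
    intro V hV ξ
    simp only [Q, aux_aeval hV, aux_trace hV]
    have hsm : ∀ (c : ℂ) (x : Fin d → ℂ), c • (V * Matrix.diagonal x * star V) =
        V * Matrix.diagonal (c • x) * star V := by
      intro c x
      rw [Matrix.diagonal_smul, mul_smul_comm, smul_mul_assoc]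
    simp only [hsm]
    rw [← Finset.sum_mul, ← Finset.mul_sum, ← add_mul, ← mul_add]
    congr 2
    ext i j
    rcases eq_or_ne i j with rfl | hij
    · simp [Matrix.sum_apply, G]
    · simp [Matrix.sum_apply, hij]
  have hdiff : ∀ V ∈ Matrix.unitaryGroup (Fin d) ℂ, ∀ ξ : Fin d → ℝ, Antitone ξ → ξ ∈ s →
      LF (V * Matrix.diagonal (fun i => (ξ i : ℂ)) * star V) -
        Q (V * Matrix.diagonal (fun i => (ξ i : ℂ)) * star V) =
        V * Matrix.diagonal (fun i => (((F ξ - G ξ) i : ℝ) : ℂ)) * star V := by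
    intro V hV ξ hξ hξs
    rw [hQ V hV, hLF _ V ξ hV hξ hξs rfl, ← sub_mul, ← mul_sub, Matrix.diagonal_sub]
    simp
  have hFG : F α - G α = 0 := by
    funext i
    simp [G, hG0 i]
  have hA0 : LF A - Q A = 0 := by
    rw [hAdec, hdiff U hU α hα (mem_of_mem_nhds hs), hFG]
    simp
  have hlo : HasFDerivAt (fun ξ => F ξ - G ξ) (0 : (Fin d → ℝ) →L[ℝ] (Fin d → ℝ)) α := by
    simpa using hM.sub hG
  have key : HasFDerivWithinAt (fun B => LF B - Q B)
      (0 : Matrix (Fin d) (Fin d) ℂ →L[ℝ] Matrix (Fin d) (Fin d) ℂ) {B | B.IsHermitian} A := by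
    obtain ⟨C, hC0, hC⟩ := aux_conj_norm (d := d)
    refine HasFDerivWithinAt.of_isLittleO ?_
    rw [Asymptotics.isLittleO_iff]
    intro ε hε
    have hlo' := hlo.isLittleO
    rw [Asymptotics.isLittleO_iff] at hlo'
    have hε' : 0 < ε / (C * d + 1) := by positivity
    have hev := (hlo' hε').and hs
    obtain ⟨δ, hδ, hball⟩ := Metric.eventually_nhds_iff.1 hev
    rw [eventually_nhdsWithin_iff, Metric.eventually_nhds_iff]
    refine ⟨δ / (d + 1), by positivity, fun B hB hBH => ?_⟩
    obtain ⟨V, hV, ξ, hξ, hBdec⟩ := aux_spectral (show B.IsHermitian from hBH)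
    have hw : ‖ξ - α‖ ≤ d * ‖B - A‖ := by
      rw [hBdec, hAdec]; exact aux_weyl_norm hU hV hα hξ
    have hlt : dist ξ α < δ := by
      rw [dist_eq_norm] at hB ⊢
      rw [lt_div_iff₀ (by positivity)] at hB
      nlinarith [norm_nonneg (B - A)]
    obtain ⟨h1, h2⟩ := hball hlt
    simp only [hFG, _root_.zero_apply, sub_zero] at h1
    have h3 : LF B - Q B = V * Matrix.diagonal (fun i => (((F ξ - G ξ) i : ℝ) : ℂ)) * star V := by
      rw [hBdec]; exact hdiff V hV ξ hξ h2
    change ‖LF B - Q B - (LF A - Q A) - 0‖ ≤ _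
    rw [hA0, sub_zero, sub_zero, h3]
    calc _ ≤ C * ‖F ξ - G ξ‖ := hC V hV _
      _ ≤ C * (ε / (C * d + 1) * (d * ‖B - A‖)) := by
        gcongr
        exact h1.trans (by gcongr)
      _ = (C * d / (C * d + 1)) * (ε * ‖B - A‖) := by ring
      _ ≤ 1 * (ε * ‖B - A‖) := by
        gcongr
        rw [div_le_one (by positivity)]
        linarith
      _ = _ := one_mul _
  have := key.differentiableWithinAt.add (hQd A).differentiableWithinAt
  refine this.congr (fun B _ => ?_) ?_ <;> simp
end
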